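/- arXiv:2211.00626 — 2 statements merged into one kernel-verified Lean document; each statement's English description precedes it below -/
import Mathlib

section
/- Let G₀ be a finite weighted multigraph with vertex set V₀ and edge set E₀, let a, b, x be three vertices not in V₀, and let ε ∈ {-1, +1}. Let S be any finite set of weighted edges, each of which joins some vertex of V₀ to a or to b. Construct G with vertex set V₀ ∪ {a, b} and edge set E₀ ∪ {(a,b)} ∪ S, where the edge (a,b) is given weight ε/2. Construct G' with vertex set V₀ ∪ {a, x, b} and edge set E₀ ∪ {(a,x), (b,x)} ∪ S, where the edges (a,x) and (b,x) are each given weight ε. Then |2·τ(G)| = |τ(G')|; more precisely, τ(G') = 2·τ(G) if ε = +1 and τ(G') = -2·τ(G) if ε = -1. -/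
/-- A finite weighted multigraph: finite vertex and edge sets, an endpoint map
assigning to each edge an unordered pair of (not necessarily distinct) vertices,
and a rational weight on each edge. -/
structure WMGraph where
  V : Type
  E : Type
  [fintypeV : Fintype V]
  [decEqV : DecidableEq V]
  [fintypeE : Fintype E]
  [decEqE : DecidableEq E]
  ends : E → Sym2 V
  w : E → ℚ

attribute [instance] WMGraph.fintypeV WMGraph.decEqV WMGraph.fintypeE WMGraph.decEqE

namespace WMGraph

/-- Two vertices are joined by a walk in the subgraph with edge set `T`. -/
def Reach (G : WMGraph) (T : Finset G.E) (x y : G.V) : Prop :=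
  Relation.ReflTransGen (fun u v => ∃ e ∈ T, G.ends e = s(u, v)) x y

/-- The subgraph with edge set `T` is connected (spanning all vertices). -/
def ConnectedOn (G : WMGraph) (T : Finset G.E) : Prop :=
  ∀ x y : G.V, G.Reach T x y

/-- The subgraph with edge set `T` is acyclic: every edge of `T` is a bridge,
i.e. its endpoints are not joined after the edge is removed. -/
def AcyclicOn (G : WMGraph) (T : Finset G.E) : Prop :=
  ∀ e ∈ T, ∀ x y : G.V, G.ends e = s(x, y) → ¬ G.Reach (T.erase e) x y

/-- `T` is a spanning tree: connected and acyclic spanning subgraph. -/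
def IsSpanningTree (G : WMGraph) (T : Finset G.E) : Prop :=
  G.ConnectedOn T ∧ G.AcyclicOn T

open Classical in
/-- The tree weight `τ(G)`: the sum over all spanning trees of the product of
the weights of their edges. -/
noncomputable def treeWeight (G : WMGraph) : ℚ :=
  ∑ T ∈ Finset.univ.filter (fun T : Finset G.E => G.IsSpanningTree T),
    ∏ e ∈ T, G.w e

end WMGraph

namespace Finset

variable {α β : Type*}

theorem erase_inl_disjSum [DecidableEq α] [DecidableEq β] (s : Finset α) (t : Finset β) (a : α) :
    (s.disjSum t).erase (Sum.inl a) = (s.erase a).disjSum t := by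
  ext (x | x) <;> simp

theorem erase_inr_disjSum [DecidableEq α] [DecidableEq β] (s : Finset α) (t : Finset β) (b : β) :
    (s.disjSum t).erase (Sum.inr b) = s.disjSum (t.erase b) := by
  ext (x | x) <;> simp

theorem sum_univ_disjSum [Fintype α] [Fintype β] {M : Type*} [AddCommMonoid M]
    (f : Finset (α ⊕ β) → M) :
    ∑ T, f T = ∑ A : Finset α, ∑ B : Finset β, f (A.disjSum B) := by
  rw [← Fintype.sum_prod_type' (f := fun (A : Finset α) (B : Finset β) => f (A.disjSum B))]
  exact (Equiv.sum_comp Finset.sumEquiv.symm.toEquiv f).symm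

end Finset

namespace WMGraph

/-- `f` takes equivalent values at the two ends of every edge of `T`. -/
def EdgeInvariant (G : WMGraph) (T : Finset G.E) (f : G.V → Prop) : Prop :=
  ∀ e ∈ T, ∀ x y : G.V, G.ends e = s(x, y) → (f x ↔ f y)

theorem EdgeInvariant.iff_of_reach {G : WMGraph} {T : Finset G.E} {f : G.V → Prop}
    (hf : G.EdgeInvariant T f) {x y : G.V} (h : G.Reach T x y) : f x ↔ f y := by
  induction h with
  | refl => rfl
  | tail _ h ih =>
    obtain ⟨e, he, h⟩ := h
    exact ih.trans (hf e he _ _ h)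

theorem edgeInvariant_reach (G : WMGraph) (T : Finset G.E) (x : G.V) :
    G.EdgeInvariant T (G.Reach T x) := by
  intro e he u v h
  exact ⟨fun hu => hu.tail ⟨e, he, h⟩, fun hv => hv.tail ⟨e, he, h.trans Sym2.eq_swap⟩⟩

theorem connectedOn_iff (G : WMGraph) (T : Finset G.E) :
    G.ConnectedOn T ↔ ∀ f, G.EdgeInvariant T f → ∀ x y, f x ↔ f y :=
  ⟨fun h _ hf x y => hf.iff_of_reach (h x y),
    fun h x y => (h _ (G.edgeInvariant_reach T x) x y).1 .refl⟩

/-- Spanning trees are the minimal connected edge sets. -/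
theorem isSpanningTree_iff (G : WMGraph) (T : Finset G.E) :
    G.IsSpanningTree T ↔ G.ConnectedOn T ∧ ∀ e ∈ T, ¬ G.ConnectedOn (T.erase e) := by
  refine and_congr_right fun hT => forall₂_congr fun e he => ⟨fun h hc => ?_, fun h x y hxy hr => ?_⟩
  · obtain ⟨x, y, hxy⟩ : ∃ x y, G.ends e = s(x, y) := by
      induction G.ends e with | _ x y => exact ⟨x, y, rfl⟩
    exact h x y hxy (hc x y)
  · refine h ((G.connectedOn_iff _).2 fun f hf => (G.connectedOn_iff T).1 hT f ?_)
    intro e' he' u v huv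
    by_cases hee : e' = e
    · subst hee
      have hxy' := hf.iff_of_reach hr
      rcases Sym2.eq_iff.1 (huv.symm.trans hxy) with ⟨rfl, rfl⟩ | ⟨rfl, rfl⟩
      · exact hxy'
      · exact hxy'.symm
    · exact hf e' (Finset.mem_erase.2 ⟨hee, he'⟩) u v huv

theorem forall_mk_eq_mk_imp_iff {α : Type*} (f : α → Prop) (u v : α) :
    (∀ x y, s(u, v) = s(x, y) → (f x ↔ f y)) ↔ (f u ↔ f v) := by
  refine ⟨fun h => h u v rfl, fun h x y hxy => ?_⟩
  rcases Sym2.eq_iff.1 hxy with ⟨rfl, rfl⟩ | ⟨rfl, rfl⟩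
  · exact h
  · exact h.symm

theorem forall_map_eq_mk_imp_iff {α β : Type*} (i : α → β) (f : β → Prop) (z : Sym2 α) :
    (∀ x y, z.map i = s(x, y) → (f x ↔ f y)) ↔
      ∀ x y, z = s(x, y) → (f (i x) ↔ f (i y)) := by
  induction z with | _ u v => ?_
  rw [Sym2.map_mk, forall_mk_eq_mk_imp_iff f, forall_mk_eq_mk_imp_iff (fun x => f (i x))]

section Subdivision

variable {V₀ E₀ ES : Type} [Fintype V₀] [DecidableEq V₀] [Fintype E₀] [DecidableEq E₀]
  [Fintype ES] [DecidableEq ES]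
  (ends₀ : E₀ → Sym2 V₀) (w₀ : E₀ → ℚ) (endS : ES → V₀ × Fin 2) (wS : ES → ℚ) (ε : ℚ)

/-- The graph in which the new vertices `a`, `b` are joined by one edge of weight `ε / 2`. -/
abbrev joinedGraph : WMGraph where
  V := V₀ ⊕ Fin 2
  E := E₀ ⊕ (Unit ⊕ ES)
  ends := Sum.elim (fun e => (ends₀ e).map Sum.inl) <|
    Sum.elim (fun _ => s(Sum.inr 0, Sum.inr 1))
      fun s => s(Sum.inl (endS s).1, Sum.inr (endS s).2)
  w := Sum.elim w₀ (Sum.elim (fun _ => ε / 2) wS)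

/-- The graph in which the new vertices `a`, `b` are joined by a path through `x`, both edges
having weight `ε`. -/
abbrev subdividedGraph : WMGraph where
  V := V₀ ⊕ Fin 3
  E := E₀ ⊕ (Bool ⊕ ES)
  ends := Sum.elim (fun e => (ends₀ e).map Sum.inl) <|
    Sum.elim (fun b => s(Sum.inr (if b then 1 else 0), Sum.inr 2))
      fun s => s(Sum.inl (endS s).1, Sum.inr (Fin.castSucc (endS s).2))
  w := Sum.elim w₀ (Sum.elim (fun _ => ε) wS)

/-- `g` takes equivalent values at the two ends of every edge of `A` in the base graph, and at
the two ends of every edge of `C` between the base graph and the new vertices. -/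
def BaseInvariant (A : Finset E₀) (C : Finset ES) (g : V₀ → Prop) (h : Fin 2 → Prop) : Prop :=
  (∀ e ∈ A, ∀ x y, ends₀ e = s(x, y) → (g x ↔ g y)) ∧ ∀ s ∈ C, g (endS s).1 ↔ h (endS s).2


theorem edgeInvariant_joinedGraph_iff (A : Finset E₀) (B : Finset Unit) (C : Finset ES)
    (f : V₀ ⊕ Fin 2 → Prop) :
    (joinedGraph ends₀ w₀ endS wS ε).EdgeInvariant (A.disjSum (B.disjSum C)) f ↔
      BaseInvariant ends₀ endS A C (fun v => f (.inl v)) (fun i => f (.inr i)) ∧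
        (() ∈ B → (f (.inr 0) ↔ f (.inr 1))) := by
  constructor
  · intro h
    exact ⟨⟨fun e he => (forall_map_eq_mk_imp_iff _ f _).1 (h (.inl e) (by simpa using he)),
      fun s hs => (forall_mk_eq_mk_imp_iff f _ _).1 (h (.inr (.inr s)) (by simpa using hs))⟩,
      fun hB => (forall_mk_eq_mk_imp_iff f _ _).1 (h (.inr (.inl ())) (by simpa using hB))⟩
  · rintro ⟨⟨hA, hC⟩, hB⟩ (e | ⟨⟨⟩⟩ | s) he
    · exact (forall_map_eq_mk_imp_iff _ f _).2 (hA e (by simpa using he))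
    · exact (forall_mk_eq_mk_imp_iff f _ _).2 (hB (by simpa using he))
    · exact (forall_mk_eq_mk_imp_iff f _ _).2 (hC s (by simpa using he))

theorem edgeInvariant_subdividedGraph_iff (A : Finset E₀) (B : Finset Bool) (C : Finset ES)
    (f : V₀ ⊕ Fin 3 → Prop) :
    (subdividedGraph ends₀ w₀ endS wS ε).EdgeInvariant (A.disjSum (B.disjSum C)) f ↔
      BaseInvariant ends₀ endS A C (fun v => f (.inl v)) (fun i => f (.inr i.castSucc)) ∧
        ∀ b ∈ B, f (.inr (if b then 1 else 0)) ↔ f (.inr 2) := by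
  constructor
  · intro h
    exact ⟨⟨fun e he => (forall_map_eq_mk_imp_iff _ f _).1 (h (.inl e) (by simpa using he)),
      fun s hs => (forall_mk_eq_mk_imp_iff f _ _).1 (h (.inr (.inr s)) (by simpa using hs))⟩,
      fun b hB => (forall_mk_eq_mk_imp_iff f _ _).1 (h (.inr (.inl b)) (by simpa using hB))⟩
  · rintro ⟨⟨hA, hC⟩, hB⟩ (e | b | s) he
    · exact (forall_map_eq_mk_imp_iff _ f _).2 (hA e (by simpa using he))
    · exact (forall_mk_eq_mk_imp_iff f _ _).2 (hB b (by simpa using he))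
    · exact (forall_mk_eq_mk_imp_iff f _ _).2 (hC s (by simpa using he))

theorem not_connectedOn_subdividedGraph_empty (A : Finset E₀) (C : Finset ES) :
    ¬ (subdividedGraph ends₀ w₀ endS wS ε).ConnectedOn
      (A.disjSum ((∅ : Finset Bool).disjSum C)) := by
  rw [connectedOn_iff]
  intro h
  have := h (fun v => v = .inr 2) ((edgeInvariant_subdividedGraph_iff ..).2 ?_) (.inr 0) (.inr 2)
  · simp at this
  · simp only [BaseInvariant, reduceCtorEq, implies_true, Sum.inr.injEq, false_iff, true_and,
      Finset.notMem_empty, false_imp_iff, and_true]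
    exact fun s _ => (Fin.castSucc_lt_last _).ne

/-- A nonempty set of the two edges at `x` connects as much as the edge `ab` if it contains both
of them, and as much as no edge otherwise. -/
theorem connectedOn_subdividedGraph_iff (A : Finset E₀) (C : Finset ES) {B : Finset Bool}
    (hB : B.Nonempty) {D : Finset Unit} (hD : () ∈ D ↔ B = Finset.univ) :
    (subdividedGraph ends₀ w₀ endS wS ε).ConnectedOn (A.disjSum (B.disjSum C)) ↔
      (joinedGraph ends₀ w₀ endS wS ε).ConnectedOn (A.disjSum (D.disjSum C)) := by
  simp only [connectedOn_iff]
  obtain ⟨b, hb⟩ := hB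
  constructor
  · intro h f hf x y
    obtain ⟨hf, hab⟩ := (edgeInvariant_joinedGraph_iff ..).1 hf
    let f' : V₀ ⊕ Fin 3 → Prop := Sum.elim (fun v => f (.inl v))
      ![f (.inr 0), f (.inr 1), f (.inr (if b then 1 else 0))]
    have hf' : ∀ z : V₀ ⊕ Fin 2, f' (z.map id Fin.castSucc) = f z := by
      rintro (v | i)
      · rfl
      · fin_cases i <;> rfl
    rw [← hf' x, ← hf' y]
    refine h f' ((edgeInvariant_subdividedGraph_iff ..).2 ⟨⟨hf.1, fun s hs => ?_⟩, ?_⟩) _ _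
    · exact (hf.2 s hs).trans (iff_of_eq (hf' (.inr (endS s).2)).symm)
    · intro c hc
      by_cases hcb : c = b
      · subst hcb
        cases c <;> rfl
      · have hBu : B = Finset.univ := by
          ext d
          cases b <;> cases c <;> cases d <;> simp_all
        have := hab (hD.2 hBu)
        cases b <;> cases c <;> simp_all [f']
  · intro h f hf x y
    obtain ⟨hf, hx⟩ := (edgeInvariant_subdividedGraph_iff ..).1 hf
    have key := h (fun z => f (z.map id Fin.castSucc))
      ((edgeInvariant_joinedGraph_iff ..).2 ⟨hf, fun hd => ?_⟩)
    · have hz : ∀ z : V₀ ⊕ Fin 3, ∃ z' : V₀ ⊕ Fin 2, f z ↔ f (z'.map id Fin.castSucc) := by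
        rintro (v | i)
        · exact ⟨.inl v, Iff.rfl⟩
        · induction i using Fin.lastCases with
          | cast i => exact ⟨.inr i, Iff.rfl⟩
          | last =>
            refine ⟨.inr (if b then 1 else 0), (hx b hb).symm.trans ?_⟩
            cases b <;> rfl
      obtain ⟨x', hx'⟩ := hz x
      obtain ⟨y', hy'⟩ := hz y
      exact hx'.trans ((key x' y').trans hy'.symm)
    · have hBu := hD.1 hd
      subst hBu
      exact (hx false (Finset.mem_univ _)).trans (hx true (Finset.mem_univ _)).symm

theorem not_isSpanningTree_subdividedGraph_empty (A : Finset E₀) (C : Finset ES) :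
    ¬ (subdividedGraph ends₀ w₀ endS wS ε).IsSpanningTree
      (A.disjSum ((∅ : Finset Bool).disjSum C)) :=
  fun h => not_connectedOn_subdividedGraph_empty ends₀ w₀ endS wS ε A C h.1

theorem isSpanningTree_subdividedGraph_iff (A : Finset E₀) (C : Finset ES) {B : Finset Bool}
    (hB : B.Nonempty) {D : Finset Unit} (hD : () ∈ D ↔ B = Finset.univ) :
    (subdividedGraph ends₀ w₀ endS wS ε).IsSpanningTree (A.disjSum (B.disjSum C)) ↔
      (joinedGraph ends₀ w₀ endS wS ε).IsSpanningTree (A.disjSum (D.disjSum C)) := by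
  have hBD : (∀ b ∈ B, ¬ (subdividedGraph ends₀ w₀ endS wS ε).ConnectedOn
        (A.disjSum ((B.erase b).disjSum C))) ↔
      ∀ d ∈ D, ¬ (joinedGraph ends₀ w₀ endS wS ε).ConnectedOn
        (A.disjSum ((D.erase d).disjSum C)) := by
    by_cases hBu : B = Finset.univ
    · have hd := hD.2 hBu
      subst hBu
      have hb : ∀ b : Bool, (Finset.univ.erase b).Nonempty ∧ Finset.univ.erase b ≠ Finset.univ := by
        decide
      have hDe : ∀ d, () ∉ D.erase d := by simp
      have key := fun b => connectedOn_subdividedGraph_iff ends₀ w₀ endS wS ε A C (hb b).1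
        (D := D.erase ()) (iff_of_false (hDe _) (hb b).2)
      simp only [key]
      exact ⟨fun h _ _ => h true (Finset.mem_univ _), fun h _ _ => h () hd⟩
    · refine iff_of_true (fun b hb => ?_) fun d hd => absurd (hD.1 hd) hBu
      have erase_eq : ∀ B : Finset Bool, B ≠ Finset.univ → ∀ b ∈ B, B.erase b = ∅ := by decide
      rw [erase_eq B hBu b hb]
      exact not_connectedOn_subdividedGraph_empty ends₀ w₀ endS wS ε A C
  have key := fun A C => connectedOn_subdividedGraph_iff ends₀ w₀ endS wS ε A C hB hD
  simp only [isSpanningTree_iff, Sum.forall, Finset.inl_mem_disjSum, Finset.inr_mem_disjSum,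
    Finset.erase_inl_disjSum, Finset.erase_inr_disjSum, key, hBD]

open Classical in
theorem treeWeight_joinedGraph :
    (joinedGraph ends₀ w₀ endS wS ε).treeWeight =
      ∑ A : Finset E₀, ∑ C : Finset ES,
        ((if (joinedGraph ends₀ w₀ endS wS ε).IsSpanningTree
            (A.disjSum ((∅ : Finset Unit).disjSum C)) then 1 else 0) +
          (if (joinedGraph ends₀ w₀ endS wS ε).IsSpanningTree
            (A.disjSum (({()} : Finset Unit).disjSum C)) then ε / 2 else 0)) *
        ((∏ e ∈ A, w₀ e) * ∏ s ∈ C, wS s) := by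
  rw [treeWeight, Finset.sum_filter, Finset.sum_univ_disjSum]
  refine Finset.sum_congr rfl fun A _ => ?_
  rw [Finset.sum_univ_disjSum, Finset.sum_comm]
  refine Finset.sum_congr rfl fun C _ => ?_
  rw [show (Finset.univ : Finset (Finset Unit)) = {∅, {()}} by decide,
    Finset.sum_pair (by decide)]
  simp only [Finset.prod_disjSum, Finset.prod_empty, Finset.prod_singleton,
    Sum.elim_inl, Sum.elim_inr]
  split_ifs <;> ring

open Classical in
theorem treeWeight_subdividedGraph :
    (subdividedGraph ends₀ w₀ endS wS ε).treeWeight =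
      ∑ A : Finset E₀, ∑ C : Finset ES,
        ((if (joinedGraph ends₀ w₀ endS wS ε).IsSpanningTree
            (A.disjSum ((∅ : Finset Unit).disjSum C)) then 2 * ε else 0) +
          (if (joinedGraph ends₀ w₀ endS wS ε).IsSpanningTree
            (A.disjSum (({()} : Finset Unit).disjSum C)) then ε ^ 2 else 0)) *
        ((∏ e ∈ A, w₀ e) * ∏ s ∈ C, wS s) := by
  rw [treeWeight, Finset.sum_filter, Finset.sum_univ_disjSum]
  refine Finset.sum_congr rfl fun A _ => ?_
  rw [Finset.sum_univ_disjSum, Finset.sum_comm]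
  refine Finset.sum_congr rfl fun C _ => ?_
  rw [show (Finset.univ : Finset (Finset Bool)) = {∅, {false}, {true}, Finset.univ} by decide,
    Finset.sum_insert (by decide), Finset.sum_insert (by decide), Finset.sum_pair (by decide)]
  have h₁ := fun b : Bool => isSpanningTree_subdividedGraph_iff ends₀ w₀ endS wS ε A C
    (Finset.singleton_nonempty b) (D := ∅) (by revert b; decide)
  have h₂ := isSpanningTree_subdividedGraph_iff ends₀ w₀ endS wS ε A C
    (B := Finset.univ) Finset.univ_nonempty (D := {()}) (by decide)
  simp only [not_isSpanningTree_subdividedGraph_empty, h₁, h₂, Finset.prod_disjSum,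
    Finset.prod_empty, Finset.prod_singleton, Fintype.prod_bool, Sum.elim_inl,
    Sum.elim_inr, if_false]
  split_ifs <;> ring

theorem treeWeight_subdividedGraph_eq :
    (subdividedGraph ends₀ w₀ endS wS ε).treeWeight =
      2 * ε * (joinedGraph ends₀ w₀ endS wS ε).treeWeight := by
  classical
  rw [treeWeight_subdividedGraph, treeWeight_joinedGraph]
  simp only [Finset.mul_sum]
  refine Finset.sum_congr rfl fun A _ => Finset.sum_congr rfl fun C _ => ?_
  split_ifs <;> ring

end Subdivision

end WMGraph

/-- Let `G₀ = (V₀, E₀)` be a finite weighted multigraph, let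
`a, b, x` be three new vertices and `ε ∈ {-1, +1}`.  Let `S` be any finite set of
weighted edges joining vertices of `V₀` to `a` or to `b` (encoded by `endS`, `wS`).
Form `G` on `V₀ ∪ {a, b}` with edges `E₀ ∪ {(a,b)} ∪ S`, the edge `(a,b)` having
weight `ε/2`, and form `G'` on `V₀ ∪ {a, x, b}` with edges `E₀ ∪ {(a,x),(b,x)} ∪ S`,
the edges `(a,x)` and `(b,x)` each having weight `ε`.  Then `|2·τ(G)| = |τ(G')|`;
more precisely `τ(G') = 2τ(G)` if `ε = 1` and `τ(G') = -2τ(G)` if `ε = -1`.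
(Here `a, b` are the vertices `Sum.inr 0, Sum.inr 1` of `V₀ ⊕ Fin 2`, and
`a, b, x` are `Sum.inr 0, Sum.inr 1, Sum.inr 2` of `V₀ ⊕ Fin 3`.) -/
theorem tree_weight_subdivide (V₀ E₀ ES : Type)
    [Fintype V₀] [DecidableEq V₀] [Fintype E₀] [DecidableEq E₀]
    [Fintype ES] [DecidableEq ES]
    (ends₀ : E₀ → Sym2 V₀) (w₀ : E₀ → ℚ)
    (endS : ES → V₀ × Fin 2) (wS : ES → ℚ)
    (ε : ℚ) (hε : ε = 1 ∨ ε = -1) :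
    let G : WMGraph :=
      { V := V₀ ⊕ Fin 2
        E := E₀ ⊕ (Unit ⊕ ES)
        ends := fun e => match e with
          | Sum.inl e₀ => (ends₀ e₀).map Sum.inl
          | Sum.inr (Sum.inl _) => s(Sum.inr 0, Sum.inr 1)
          | Sum.inr (Sum.inr s) => s(Sum.inl (endS s).1, Sum.inr (endS s).2)
        w := fun e => match e with
          | Sum.inl e₀ => w₀ e₀
          | Sum.inr (Sum.inl _) => ε / 2
          | Sum.inr (Sum.inr s) => wS s }
    let G' : WMGraph :=
      { V := V₀ ⊕ Fin 3
        E := E₀ ⊕ (Bool ⊕ ES)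
        ends := fun e => match e with
          | Sum.inl e₀ => (ends₀ e₀).map Sum.inl
          | Sum.inr (Sum.inl b) => s(Sum.inr (if b then 1 else 0), Sum.inr 2)
          | Sum.inr (Sum.inr s) =>
              s(Sum.inl (endS s).1, Sum.inr (Fin.castSucc (endS s).2))
        w := fun e => match e with
          | Sum.inl e₀ => w₀ e₀
          | Sum.inr (Sum.inl _) => ε
          | Sum.inr (Sum.inr s) => wS s }
    |2 * G.treeWeight| = |G'.treeWeight| ∧
      (ε = 1 → G'.treeWeight = 2 * G.treeWeight) ∧
      (ε = -1 → G'.treeWeight = -(2 * G.treeWeight)) := by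
  intro G G'
  have hG : WMGraph.joinedGraph ends₀ w₀ endS wS ε = G := by
    unfold WMGraph.joinedGraph
    congr 1 <;> (funext e; rcases e with e | e | e <;> rfl)
  have hG' : WMGraph.subdividedGraph ends₀ w₀ endS wS ε = G' := by
    unfold WMGraph.subdividedGraph
    congr 1 <;> (funext e; rcases e with e | e | e <;> rfl)
  have h : G'.treeWeight = 2 * ε * G.treeWeight :=
    hG ▸ hG' ▸ WMGraph.treeWeight_subdividedGraph_eq ends₀ w₀ endS wS ε
  rcases hε with rfl | rfl
  · refine ⟨by rw [h, mul_one], fun _ => by rw [h, mul_one], fun h' => by norm_num at h'⟩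
  · refine ⟨?_, fun h' => by norm_num at h', fun _ => by rw [h]; ring⟩
    rw [h, ← abs_neg]
    congr 1
    ring
end

section
/- (Weighted Matrix Tree Theorem.) Let G be a finite weighted multigraph with vertex set {v₀, …, vₙ} and rational edge weights, with no self-loops. Define its Laplacian to be the (n+1)×(n+1) matrix L̃ = [ℓ_ij] where, for i ≠ j, ℓ_ij = -ω_ij with ω_ij the sum of the weights of all edges joining v_i and v_j, and ℓ_ii = Σ_{k ≠ i} ω_ik. Let L be the reduced Laplacian obtained from L̃ by deleting any one row and any one column. Then |det(L)| = |τ(G)|. -/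
namespace Matrix

theorem transpose_mul_diagonal_mul_apply {m E R : Type*} [Fintype E] [DecidableEq E]
    [CommRing R] (A B : Matrix E m R) (w : E → R) (i j : m) :
    (Aᵀ * diagonal w * B) i j = ∑ e, w e * (A e i * B e j) := by
  rw [mul_apply]
  simp only [mul_diagonal, transpose_apply]
  exact Finset.sum_congr rfl fun e _ => by ring

variable {m E R : Type*} [Fintype m] [DecidableEq m] [Fintype E] [DecidableEq E] [CommRing R]

/-- The determinant of `∑ e, w e • aₑ bₑᵀ` as a sum over injections of the row index into `E`. -/
theorem det_transpose_mul_diagonal_mul (A B : Matrix E m R) (w : E → R) :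
    (Aᵀ * diagonal w * B).det =
      ∑ f : m → E with Function.Injective f,
        (∏ i, w (f i)) * ((∏ i, A (f i) i) * (B.submatrix f id).det) := by
  have hrow : Aᵀ * diagonal w * B =
      (fun i => ∑ e, (w e * A e i) • (fun j => B e j) : m → m → R) := by
    ext i j
    simp [transpose_mul_diagonal_mul_apply, mul_assoc]
  have hdet : (Aᵀ * diagonal w * B).det =
      (detRowAlternating : (m → R) [⋀^m]→ₗ[R] R).toMultilinearMap
        (fun i => ∑ e, (w e * A e i) • (fun j => B e j)) := by
    rw [hrow]; rfl
  rw [hdet, MultilinearMap.map_sum]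
  simp_rw [MultilinearMap.map_smul_univ, Finset.prod_mul_distrib, smul_eq_mul, mul_assoc]
  symm
  apply Finset.sum_subset (Finset.filter_subset _ _)
  intro f _ hf
  have hf' : ¬ Function.Injective f := by simpa using hf
  simp only [Function.Injective, not_forall] at hf'
  obtain ⟨a, b, hab, hne⟩ := hf'
  have : (B.submatrix f id).det = 0 := det_zero_of_row_eq hne (by ext j; simp [hab])
  rw [this]; simp

/-- A weighted form of the Cauchy–Binet formula. -/
theorem det_transpose_mul_diagonal_mul_eq_sum_powersetCard (A B : Matrix E m R) (w : E → R) :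
    (Aᵀ * diagonal w * B).det =
      ∑ T ∈ Finset.univ.powersetCard (Fintype.card m),
        (∏ e ∈ T, w e) * ((A.submatrix (Subtype.val : T → E) id)ᵀ *
          B.submatrix (Subtype.val : T → E) id).det := by
  have himage : ∀ f : m → E, Function.Injective f →
      (Finset.univ.image f).card = Fintype.card m := fun f hf => by
    rw [Finset.card_image_of_injective _ hf, Finset.card_univ]
  rw [det_transpose_mul_diagonal_mul,
    ← Finset.sum_fiberwise_of_maps_to (g := fun f => Finset.univ.image f)
      (t := Finset.univ.powersetCard (Fintype.card m))
      (fun f hf => Finset.mem_powersetCard_univ.2 (himage f (by simpa using hf)))]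
  refine Finset.sum_congr rfl fun T hT => ?_
  rw [Finset.mem_powersetCard_univ] at hT
  have hgram : (A.submatrix (Subtype.val : T → E) id)ᵀ * B.submatrix (Subtype.val : T → E) id =
      Aᵀ * diagonal (fun e => if e ∈ T then (1 : R) else 0) * B := by
    ext i j
    rw [transpose_mul_diagonal_mul_apply]
    simpa [mul_apply] using Finset.sum_coe_sort T (fun e => A e i * B e j)
  rw [hgram, det_transpose_mul_diagonal_mul, Finset.mul_sum, Finset.sum_filter, Finset.sum_filter,
    Finset.sum_filter]
  refine Finset.sum_congr rfl fun f _ => ?_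
  by_cases hf : Function.Injective f
  · simp only [hf, if_true]
    by_cases hfT : Finset.univ.image f = T
    · have hmem : ∀ i, f i ∈ T := fun i => hfT ▸ Finset.mem_image_of_mem f (Finset.mem_univ i)
      have hprod : ∏ e ∈ T, w e = ∏ i, w (f i) := by
        rw [← hfT, Finset.prod_image hf.injOn]
      simp [hfT, hmem, hprod]
    · have : ∃ i, f i ∉ T := by
        by_contra! h
        exact hfT (Finset.eq_of_subset_of_card_le (by simpa [Finset.image_subset_iff] using h)
          (by rw [hT, himage f hf]))
      obtain ⟨i, hi⟩ := this
      rw [if_neg hfT, Finset.prod_eq_zero (Finset.mem_univ i) (if_neg hi)]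
      simp
  · simp [hf]

theorem card_le_card_of_mul_eq_one {n : Type*} [Fintype n] [Nontrivial R]
    {A : Matrix m n R} {B : Matrix n m R} (h : A * B = 1) : Fintype.card m ≤ Fintype.card n := by
  rw [← rank_one (R := R) (n := m), ← h]
  exact (rank_mul_le_left A B).trans A.rank_le_card_width

end Matrix

namespace WMGraph

open scoped Matrix

variable {G : WMGraph} {T : Finset G.E} {r : G.V}

theorem Reach.symm {x y : G.V} (h : G.Reach T x y) : G.Reach T y x :=
  haveI : Std.Symm fun u v => ∃ e ∈ T, G.ends e = s(u, v) :=
    ⟨fun _ _ ⟨e, he, hxy⟩ => ⟨e, he, hxy.trans Sym2.eq_swap⟩⟩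
  Relation.ReflTransGen.stdSymm.symm _ _ h

theorem Reach.of_mem {e : G.E} (he : e ∈ T) {x y : G.V} (h : G.ends e = s(x, y)) :
    G.Reach T x y :=
  Relation.ReflTransGen.single ⟨e, he, h⟩

theorem ConnectedOn.erase (hT : G.ConnectedOn T) {e : G.E} {x y : G.V}
    (he : G.ends e = s(x, y)) (hxy : G.Reach (T.erase e) x y) : G.ConnectedOn (T.erase e) := by
  intro a b
  induction hT a b with
  | refl => exact .refl
  | @tail b c _ hbc ih =>
    obtain ⟨f, hf, hfbc⟩ := hbc
    refine Relation.ReflTransGen.trans ih ?_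
    by_cases hfe : f = e
    · subst hfe
      rw [he, Sym2.eq_iff] at hfbc
      obtain ⟨rfl, rfl⟩ | ⟨rfl, rfl⟩ := hfbc
      · exact hxy
      · exact hxy.symm
    · exact Reach.of_mem (Finset.mem_erase.2 ⟨hfe, hf⟩) hfbc

theorem ends_eq_out (e : G.E) : G.ends e = s((G.ends e).out.1, (G.ends e).out.2) :=
  (Quot.out_eq (G.ends e)).symm

variable (G) in
/-- The signed incidence matrix, for an arbitrary orientation of the edges. -/
noncomputable def incidence : Matrix G.E G.V ℤ := fun e =>
  Pi.single (G.ends e).out.1 1 - Pi.single (G.ends e).out.2 1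

variable (r T) in
/-- The signed incidence matrix of the subgraph with edge set `T`, with the column of the
vertex `r` removed. -/
noncomputable def reducedIncidence : Matrix T {v : G.V // v ≠ r} ℤ :=
  G.incidence.submatrix Subtype.val Subtype.val

theorem reducedIncidence_mulVec (φ : G.V → ℤ) (hφ : φ r = 0) (e : T) :
    (reducedIncidence T r *ᵥ fun v => φ v) e =
      φ (G.ends e).out.1 - φ (G.ends e).out.2 := by
  have h : ∑ v, G.incidence e v * φ v = φ (G.ends e).out.1 - φ (G.ends e).out.2 := by
    simp [incidence, sub_mul, Finset.sum_sub_distrib, Pi.single_apply]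
  rw [← h, Fintype.sum_eq_add_sum_subtype_ne _ r, hφ, mul_zero, zero_add]
  rfl

theorem Reach.exists_vecMul_eq {x y : G.V} (h : G.Reach T x y) :
    ∃ c : T → ℤ, c ᵥ* G.incidence.submatrix (Subtype.val : T → G.E) id =
      Pi.single x 1 - Pi.single y 1 := by
  induction h with
  | refl => exact ⟨0, by simp⟩
  | @tail y z _ hyz ih =>
    obtain ⟨c, hc⟩ := ih
    obtain ⟨e, he, hyz⟩ := hyz
    rw [ends_eq_out, Sym2.eq_iff] at hyz
    obtain ⟨hy, hz⟩ | ⟨hy, hz⟩ := hyz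
    · refine ⟨c + Pi.single ⟨e, he⟩ 1, ?_⟩
      rw [Matrix.add_vecMul, hc, Matrix.single_one_vecMul]
      ext v
      simp [incidence, hy, hz]
    · refine ⟨c - Pi.single ⟨e, he⟩ 1, ?_⟩
      rw [Matrix.sub_vecMul, hc, Matrix.single_one_vecMul]
      ext v
      simp [incidence, hy, hz]

theorem ConnectedOn.exists_mul_reducedIncidence_eq_one (hT : G.ConnectedOn T) (r : G.V) :
    ∃ C : Matrix {v : G.V // v ≠ r} T ℤ, C * reducedIncidence T r = 1 := by
  choose c hc using fun v : G.V => (hT v r).exists_vecMul_eq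
  refine ⟨fun v => c v, ?_⟩
  ext u v
  have := congrFun (hc u) v
  simp only [Pi.sub_apply, Pi.single_eq_of_ne v.2, sub_zero] at this
  rw [Matrix.one_apply]
  refine this.trans ?_
  simp [Pi.single_apply, Subtype.ext_iff, eq_comm]

theorem ConnectedOn.card_le (hT : G.ConnectedOn T) (r : G.V) :
    Fintype.card {v : G.V // v ≠ r} ≤ T.card := by
  obtain ⟨C, hC⟩ := hT.exists_mul_reducedIncidence_eq_one r
  simpa using Matrix.card_le_card_of_mul_eq_one hC

theorem AcyclicOn.exists_reducedIncidence_mul_eq_one (hT : G.AcyclicOn T) (r : G.V) :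
    ∃ C : Matrix {v : G.V // v ≠ r} T ℤ, reducedIncidence T r * C = 1 := by
  classical
  let χ (e : T) (v : G.V) : ℤ := if G.Reach (T.erase e) (G.ends e).out.1 v then 1 else 0
  refine ⟨fun v e => χ e v - χ e r, ?_⟩
  ext e f
  refine (reducedIncidence_mulVec (fun v => χ f v - χ f r) (sub_self _) e).trans ?_
  rw [Matrix.one_apply]
  split_ifs with hef
  · subst hef
    have h1 : χ e (G.ends e).out.1 = 1 := if_pos .refl
    have h2 : χ e (G.ends e).out.2 = 0 := if_neg (hT e e.2 _ _ (ends_eq_out _))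
    simp [h1, h2]
  · have hmem : e.1 ∈ T.erase f := Finset.mem_erase.2 ⟨fun h => hef (Subtype.ext h), e.2⟩
    have hiff := Reach.of_mem hmem (ends_eq_out _)
    have : χ f (G.ends e).out.1 = χ f (G.ends e).out.2 :=
      if_congr ⟨fun h => h.trans hiff, fun h => h.trans hiff.symm⟩ rfl rfl
    simp [this]

theorem AcyclicOn.card_le (hT : G.AcyclicOn T) (r : G.V) :
    T.card ≤ Fintype.card {v : G.V // v ≠ r} := by
  obtain ⟨C, hC⟩ := hT.exists_reducedIncidence_mul_eq_one r
  simpa using Matrix.card_le_card_of_mul_eq_one hC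

theorem IsSpanningTree.card_eq (hT : G.IsSpanningTree T) (r : G.V) :
    T.card = Fintype.card {v : G.V // v ≠ r} :=
  (hT.2.card_le r).antisymm (hT.1.card_le r)

theorem ConnectedOn.isSpanningTree (hT : G.ConnectedOn T)
    (hcard : T.card = Fintype.card {v : G.V // v ≠ r}) : G.IsSpanningTree T := by
  refine ⟨hT, fun e he x y hxy hreach => ?_⟩
  have := (hT.erase hxy hreach).card_le r
  have := Finset.card_erase_lt_of_mem he
  omega

theorem exists_reducedIncidence_mulVec_eq_zero (hT : ¬ G.ConnectedOn T) (r : G.V) :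
    ∃ x ≠ 0, reducedIncidence T r *ᵥ x = 0 := by
  classical
  have : ∃ a, ¬ G.Reach T r a := by
    by_contra! h
    exact hT fun x y => (h x).symm.trans (h y)
  obtain ⟨a, ha⟩ := this
  let χ (v : G.V) : ℤ := if G.Reach T r v then 0 else 1
  have har : a ≠ r := fun h => ha (h ▸ .refl)
  refine ⟨fun v => χ v, fun h => ?_, ?_⟩
  · have := congrFun h ⟨a, har⟩
    simp [χ, ha] at this
  · ext e
    rw [reducedIncidence_mulVec χ (if_pos .refl)]
    have hiff := Reach.of_mem e.2 (ends_eq_out _)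
    have : χ (G.ends e).out.1 = χ (G.ends e).out.2 :=
      if_congr ⟨fun h => h.trans hiff, fun h => h.trans hiff.symm⟩ rfl rfl
    simp [this]

open Classical in
theorem det_transpose_mul_reducedIncidence
    (hcard : T.card = Fintype.card {v : G.V // v ≠ r}) :
    ((reducedIncidence T r)ᵀ * reducedIncidence T r).det =
      if G.IsSpanningTree T then 1 else 0 := by
  split_ifs with hT
  · obtain ⟨C, hC⟩ := hT.1.exists_mul_reducedIncidence_eq_one r
    let σ : {v : G.V // v ≠ r} ≃ T := Fintype.equivOfCardEq (by simpa using hcard.symm)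
    set B := (reducedIncidence T r).submatrix σ id with hB
    have hgram : (reducedIncidence T r)ᵀ * reducedIncidence T r = Bᵀ * B := by
      rw [hB, Matrix.transpose_submatrix, Matrix.submatrix_mul_equiv, Matrix.submatrix_id_id]
    have hinv : C.submatrix id σ * B = 1 := by
      rw [hB, Matrix.submatrix_mul_equiv, hC, Matrix.submatrix_id_id]
    rw [hgram, Matrix.det_mul, Matrix.det_transpose]
    exact Int.isUnit_mul_self (Matrix.isUnit_det_of_left_inverse hinv)
  · have hconn : ¬ G.ConnectedOn T := fun h => hT (h.isSpanningTree hcard)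
    obtain ⟨x, hx0, hx⟩ := exists_reducedIncidence_mulVec_eq_zero hconn r
    exact Matrix.exists_mulVec_eq_zero_iff.1 ⟨x, hx0, by rw [← Matrix.mulVec_mulVec, hx,
      Matrix.mulVec_zero]⟩

variable (G) in
/-- The weighted Laplacian, written in terms of the incidence matrix. -/
noncomputable def laplacian : Matrix G.V G.V ℚ :=
  (G.incidence.map (Int.cast : ℤ → ℚ))ᵀ * Matrix.diagonal G.w * G.incidence.map (Int.cast : ℤ → ℚ)

theorem laplacian_apply (u v : G.V) :
    G.laplacian u v = ∑ e, G.w e * (G.incidence e u * G.incidence e v) := by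
  simp [laplacian, Matrix.transpose_mul_diagonal_mul_apply]

theorem sum_laplacian (u : G.V) : ∑ v, G.laplacian u v = 0 := by
  have h (e : G.E) : ∑ v, (G.incidence e v : ℚ) = 0 := by
    simp [incidence, Pi.single_apply, apply_ite (Int.cast : ℤ → ℚ)]
  simp_rw [laplacian_apply]
  rw [Finset.sum_comm]
  simp_rw [← Finset.mul_sum, h, mul_zero, Finset.sum_const_zero]

theorem laplacian_comm (u v : G.V) : G.laplacian u v = G.laplacian v u := by
  simp_rw [laplacian_apply, mul_comm (G.incidence _ u : ℚ)]

theorem laplacian_apply_of_ne {u v : G.V} (huv : u ≠ v) :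
    G.laplacian u v = -∑ e with G.ends e = s(u, v), G.w e := by
  rw [laplacian_apply, Finset.sum_filter, ← Finset.sum_neg_distrib]
  refine Finset.sum_congr rfl fun e _ => ?_
  rw [ends_eq_out e]
  simp only [incidence, Sym2.eq_iff, Pi.sub_apply, Pi.single_apply]
  generalize (G.ends e).out.1 = a
  generalize (G.ends e).out.2 = b
  by_cases h1 : u = a <;> by_cases h2 : u = b <;> by_cases h3 : v = a <;> by_cases h4 : v = b <;>
    simp_all [eq_comm]

theorem det_laplacian_submatrix (r : G.V) :
    (G.laplacian.submatrix (Subtype.val : {v // v ≠ r} → G.V) Subtype.val).det =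
      G.treeWeight := by
  classical
  set A : Matrix G.E {v : G.V // v ≠ r} ℚ :=
    (G.incidence.map (Int.cast : ℤ → ℚ)).submatrix id Subtype.val
  have hL : G.laplacian.submatrix (Subtype.val : {v // v ≠ r} → G.V) Subtype.val =
      Aᵀ * Matrix.diagonal G.w * A := rfl
  have hdet (T : Finset G.E) (hT : T.card = Fintype.card {v : G.V // v ≠ r}) :
      ((A.submatrix (Subtype.val : T → G.E) id)ᵀ * A.submatrix (Subtype.val : T → G.E) id).det =
        if G.IsSpanningTree T then 1 else 0 := by
    have h := congrArg (Int.castRingHom ℚ) (det_transpose_mul_reducedIncidence hT)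
    rw [RingHom.map_det, RingHom.mapMatrix_apply, Matrix.map_mul] at h
    refine Eq.trans rfl (h.trans ?_)
    split_ifs <;> simp
  rw [hL, Matrix.det_transpose_mul_diagonal_mul_eq_sum_powersetCard, treeWeight]
  rw [Finset.sum_congr rfl fun T hT =>
    congrArg (_ * ·) (hdet T (Finset.mem_powersetCard_univ.1 hT))]
  simp_rw [mul_ite, mul_one, mul_zero, ← Finset.sum_filter]
  refine Finset.sum_congr ?_ fun _ _ => rfl
  ext T
  simp only [Finset.mem_filter, Finset.mem_univ, true_and, Finset.mem_powersetCard_univ]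
  exact ⟨fun h => h.2, fun h => ⟨h.card_eq r, h⟩⟩

end WMGraph

/-- **Weighted Matrix Tree Theorem.** Let `G` be a finite weighted
multigraph with vertex set `{v₀, …, vₙ} = Fin (n+1)`, rational edge weights and no
self-loops.  Let `ω i j` be the sum of the weights of all edges joining `vᵢ` and
`vⱼ`, and let the Laplacian `L̃` have off-diagonal entries `-ω i j` and diagonal
entries `∑_{k ≠ i} ω i k`.  If `L` is the reduced Laplacian obtained by deleting
row `i₀` and column `j₀`, then `|det L| = |τ(G)|`. -/
theorem matrix_tree_theorem (n : ℕ) (E : Type) [Fintype E] [DecidableEq E]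
    (ends : E → Sym2 (Fin (n + 1))) (w : E → ℚ)
    (hloop : ∀ e : E, ¬ (ends e).IsDiag)
    (ω : Fin (n + 1) → Fin (n + 1) → ℚ)
    (hω : ∀ i j, ω i j =
      ∑ e ∈ Finset.univ.filter (fun e : E => ends e = s(i, j)), w e)
    (L : Matrix (Fin (n + 1)) (Fin (n + 1)) ℚ)
    (hL : ∀ i j, L i j =
      if i = j then ∑ k ∈ Finset.univ.erase i, ω i k else - ω i j)
    (i₀ j₀ : Fin (n + 1)) :
    |(L.submatrix i₀.succAbove j₀.succAbove).det| =
      |WMGraph.treeWeight ⟨Fin (n + 1), E, ends, w⟩| := by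
  set G : WMGraph := ⟨Fin (n + 1), E, ends, w⟩
  have hoff : ∀ i j : Fin (n + 1), i ≠ j → L i j = G.laplacian i j := fun i j hij => by
    rw [hL, if_neg hij, hω]
    exact (WMGraph.laplacian_apply_of_ne (G := G) hij).symm
  have hLG : L = G.laplacian := by
    ext i j
    by_cases hij : i = j
    · subst hij
      have hsum : G.laplacian i i + ∑ k ∈ Finset.univ.erase i, G.laplacian i k = 0 :=
        (Finset.add_sum_erase _ _ (Finset.mem_univ i)).trans (WMGraph.sum_laplacian (G := G) i)
      have hdiag : L i i = -∑ k ∈ Finset.univ.erase i, G.laplacian i k := by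
        rw [hL, if_pos rfl, ← Finset.sum_neg_distrib]
        refine Finset.sum_congr rfl fun k hk => ?_
        have hik := (Finset.ne_of_mem_erase hk).symm
        rw [← hoff i k hik, hL, if_neg hik, neg_neg]
      linarith
    · exact hoff i j hij
  have hcol : ∑ i, L.submatrix id j₀.succAbove i = 0 := by
    funext j
    refine (Finset.sum_apply j _ _).trans ?_
    refine Eq.trans (Finset.sum_congr rfl fun i _ => ?_)
      (WMGraph.sum_laplacian (G := G) (j₀.succAbove j))
    rw [Matrix.submatrix_apply, hLG]
    exact WMGraph.laplacian_comm (G := G) _ _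
  have hdet : (L.submatrix j₀.succAbove j₀.succAbove).det = G.treeWeight := by
    rw [← WMGraph.det_laplacian_submatrix (G := G) j₀,
      ← Matrix.det_submatrix_equiv_self (finSuccAboveEquiv j₀), hLG]
    rfl
  have hsign := Matrix.submatrix_succAbove_det_eq_negOnePow_submatrix_succAbove_det
    (L.submatrix id j₀.succAbove) hcol i₀ j₀
  simp only [Matrix.submatrix_submatrix, Function.id_comp, Function.comp_id] at hsign
  rw [hsign, hdet]
  obtain h | h := Int.units_eq_one_or (Int.negOnePow (i₀ - j₀)) <;> simp [h]
end
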